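/- (Main theorem.) A sub-Möbius structure M on a set X is a Möbius structure if and only if δM(reg 𝒫_5) ⊆ R, where R = ⋂_{λ∈Λ} {v ∈ L_5 : r_λ(v) = 0} is the irreducible component of the canonical representation η_5 corresponding to the prime character χ^{32}: i.e. R is a 5-dimensional η_5-invariant subspace of L_5 on which η_5 restricts to an irreducible representation with Tr(η_5(τ)|R) = 1 for every transposition τ. -/

import Mathlib

open Equiv

/-- XOR on `Fin 4` (the Klein group structure on vertices of a tetrahedron). -/
def xor4 (a b : Fin 4) : Fin 4 :=
  ⟨(a.val ^^^ b.val) % 4, Nat.mod_lt _ (by norm_num)⟩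

/-- The underlying function of the cross-ratio homomorphism `φ : S₄ → S₃`:
a permutation of the vertices `{0,1,2,3}` of a tetrahedron induces a permutation of the
three partitions of the vertex set into two pairs of opposite edges; the partition pairing
`0` with `j+1` is indexed by `j : Fin 3`. -/
def phiFun (π : Perm (Fin 4)) (j : Fin 3) : Fin 3 :=
  ⟨(xor4 (π 0) (π ⟨j.val + 1, by omega⟩)).val - 1, by
    have h := (xor4 (π 0) (π ⟨j.val + 1, by omega⟩)).isLt
    omega⟩

lemma phiFun_leftInv : ∀ (π : Perm (Fin 4)) (j : Fin 3), phiFun π⁻¹ (phiFun π j) = j := by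
  decide

/-- The cross-ratio homomorphism `φ : S₄ → S₃`. -/
def phi (π : Perm (Fin 4)) : Perm (Fin 3) where
  toFun := phiFun π
  invFun := phiFun π⁻¹
  left_inv := phiFun_leftInv π
  right_inv := fun j => by simpa using phiFun_leftInv π⁻¹ j

/-- Restriction of a permutation `π` to a bijection between the complement of `{i}`
and the complement of `{π i}`. -/
def restrictPerm {k : ℕ} (π : Perm (Fin k)) (i : Fin k) :
    {x : Fin k // x ≠ i} ≃ {x : Fin k // x ≠ π i} where
  toFun x := ⟨π x.1, fun h => x.2 (π.injective h)⟩
  invFun y := ⟨π.symm y.1, fun h => y.2 (by simpa using congrArg π h)⟩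
  left_inv x := Subtype.ext (π.symm_apply_apply x.1)
  right_inv y := Subtype.ext (π.apply_symm_apply y.1)

/-- The induced permutation `π_i ∈ S_k` of `π ∈ S_{k+1}`: the restriction of `π` to the
complement of `{i}`, reindexed via the order preserving identifications with `Fin k`. -/
def inducedPerm {k : ℕ} (π : Perm (Fin (k + 1))) (i : Fin (k + 1)) : Perm (Fin k) :=
  ((finSuccAboveEquiv i).trans ((restrictPerm π i).trans (finSuccAboveEquiv (π i)).symm))

/-- `η₄ : S₄ → Aut(V⁴)`, `V⁴ = ℝ³`: the signed cross-ratio representation,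
`η₄(π)(e_j) = sign(π) e_{φ(π) j}`. -/
noncomputable def eta4fun (π : Equiv.Perm (Fin 4)) (v : Fin 3 → ℝ) : Fin 3 → ℝ :=
  fun j => ((Equiv.Perm.sign π : ℤ) : ℝ) * v ((phi π)⁻¹ j)

/-- The canonical representation `η₅ : S₅ → Aut(V⁵)` on the space `V⁵` of `5 × 3`
real matrices: `η₅(π)(e_i ⊗ u) = e_{π(i)} ⊗ η₄(π_i)(u)`. -/
noncomputable def eta5fun (π : Equiv.Perm (Fin 5)) (v : Fin 5 → Fin 3 → ℝ) :
    Fin 5 → Fin 3 → ℝ :=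
  fun i => eta4fun (inducedPerm π (π⁻¹ i)) (v (π⁻¹ i))

/-- `η₅(π)` as a linear endomorphism of `V⁵`. -/
noncomputable def eta5lin (π : Equiv.Perm (Fin 5)) :
    (Fin 5 → Fin 3 → ℝ) →ₗ[ℝ] (Fin 5 → Fin 3 → ℝ) where
  toFun := eta5fun π
  map_add' := by
    intro v w; funext i j; simp [eta5fun, eta4fun, mul_add]
  map_smul' := by
    intro c v; funext i j; simp [eta5fun, eta4fun, smul_eq_mul]; ring

open scoped ENNReal

/-- A semi-metric on `X`: a symmetric function `d : X² → [0,∞]` vanishing exactly on the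
diagonal, having at most one infinitely remote point `ω` (distances to `ω` from points
`≠ ω` are `∞`, and all other distances are finite). -/
structure SemiMetric (X : Type*) where
  d : X → X → ℝ≥0∞
  symm : ∀ x y, d x y = d y x
  eq_zero_iff : ∀ x y, d x y = 0 ↔ x = y
  remote : ∃ S : Set X, S.Subsingleton ∧ ∀ x y, x ≠ y → (d x y = ⊤ ↔ x ∈ S ∨ y ∈ S)

/-- The "Gromov product" `(x|y) = −ln d(x,y) ∈ [−∞,∞]`. -/
noncomputable def ip {X : Type*} (m : SemiMetric X) (x y : X) : EReal :=
  - (m.d x y).log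

open Classical in
/-- Difference `u - v` in `[−∞,∞]` with the agreement that two equal infinities cancel:
`(∞) − (∞) = 0 = (−∞) − (−∞)`. -/
noncomputable def cd2 (u v : EReal) : EReal :=
  if (u = ⊤ ∨ u = ⊥) ∧ u = v then 0 else u - v

open Classical in
/-- The combination `(p + q) − (r + s)` in `[−∞,∞]`, computed with the agreement of the
paper (`(a+∞) − (b+∞) = 0`): an infinite term on the positive side cancels against an
equal infinite term on the negative side. -/
noncomputable def cd4 (p q r s : EReal) : EReal :=
  if (p = ⊤ ∨ p = ⊥) ∧ p = r then cd2 q s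
  else if (p = ⊤ ∨ p = ⊥) ∧ p = s then cd2 q r
  else if (q = ⊤ ∨ q = ⊥) ∧ q = r then cd2 p s
  else if (q = ⊤ ∨ q = ⊥) ∧ q = s then cd2 p r
  else (p + q) - (r + s)

/-- The Möbius structure `M_d` associated with a semi-metric `d`:
`M_d(x₁,x₂,x₃,x₄) = (a,b,c)` with
`a = (x₁|x₄)+(x₂|x₃)−(x₁|x₃)−(x₂|x₄)`,
`b = (x₁|x₂)+(x₃|x₄)−(x₁|x₄)−(x₂|x₃)`,
`c = (x₂|x₄)+(x₁|x₃)−(x₁|x₂)−(x₃|x₄)`. -/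
noncomputable def Md {X : Type*} (m : SemiMetric X) (Q : Fin 4 → X) : Fin 3 → EReal :=
  ![cd4 (ip m (Q 0) (Q 3)) (ip m (Q 1) (Q 2)) (ip m (Q 0) (Q 2)) (ip m (Q 1) (Q 3)),
    cd4 (ip m (Q 0) (Q 1)) (ip m (Q 2) (Q 3)) (ip m (Q 0) (Q 3)) (ip m (Q 1) (Q 2)),
    cd4 (ip m (Q 1) (Q 3)) (ip m (Q 0) (Q 2)) (ip m (Q 0) (Q 1)) (ip m (Q 2) (Q 3))]

/-- A 4-tuple is admissible if it contains at most two equal entries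
(no value occurs three or more times). -/
def Admissible4 {X : Type*} (Q : Fin 4 → X) : Prop :=
  ∀ i j k : Fin 4, i ≠ j → i ≠ k → j ≠ k → ¬(Q i = Q j ∧ Q i = Q k)

/-- The plane `L₄ ⊂ ℝ³` of triples with `a + b + c = 0`, viewed inside `[−∞,∞]³`. -/
def L4set : Set (Fin 3 → EReal) :=
  {p | ∃ u : Fin 3 → ℝ, u 0 + u 1 + u 2 = 0 ∧ p = fun j => (u j : EReal)}

/-- The extension `L̄₄ = L₄ ∪ {A, B, C}` by the three infinitely remote points
`A = (0,∞,−∞)`, `B = (−∞,0,∞)`, `C = (∞,−∞,0)`. -/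
def Lbar4 : Set (Fin 3 → EReal) :=
  L4set ∪ {![0, ⊤, ⊥], ![⊥, 0, ⊤], ![⊤, ⊥, 0]}

open Classical in
/-- The signed action of `σ ∈ S₃` (with sign `ε`) on `[−∞,∞]³`: coordinates are permuted
by `σ` and multiplied by `−1` when `ε = −1`. -/
noncomputable def signedAct3 (ε : ℤˣ) (σ : Equiv.Perm (Fin 3)) (p : Fin 3 → EReal) :
    Fin 3 → EReal :=
  fun j => if ε = 1 then p (σ⁻¹ j) else - p (σ⁻¹ j)

/-- A sub-Möbius structure on `X`: a map `M` on admissible 4-tuples with values in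
`L̄₄ ⊂ [−∞,∞]³` such that (a) `M(πQ) = sign(π) φ(π) M(Q)` for the signed cross-ratio
homomorphism; (b) `M(Q) ∈ L₄` iff `Q` is nondegenerate; (c) `M(x₁,x₁,x₃,x₄) = (0,∞,−∞)`.
(The map is defined on all 4-tuples; only its values on admissible tuples are constrained.) -/
structure SubMoebius (X : Type*) where
  M : (Fin 4 → X) → Fin 3 → EReal
  mem_Lbar : ∀ Q, Admissible4 Q → M Q ∈ Lbar4
  equivariant : ∀ Q, Admissible4 Q → ∀ π : Equiv.Perm (Fin 4),
    M (fun k => Q (π⁻¹ k)) = signedAct3 (Equiv.Perm.sign π) (phi π) (M Q)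
  mem_L4_iff : ∀ Q, Admissible4 Q → (M Q ∈ L4set ↔ Function.Injective Q)
  diag : ∀ x z w : X, Admissible4 ![x, x, z, w] → M ![x, x, z, w] = ![0, ⊤, ⊥]

/-- A sub-Möbius structure is a Möbius structure if it is generated by a semi-metric. -/
def IsMoebius {X : Type*} (S : SubMoebius X) : Prop :=
  ∃ m : SemiMetric X, ∀ Q, Admissible4 Q → S.M Q = Md m Q

/-- `del P i = P_i`, the 4-tuple obtained from the 5-tuple `P` by deleting the
`i`-th entry. -/
def del {X : Type*} (P : Fin 5 → X) (i : Fin 5) : Fin 4 → X :=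
  fun k => P (i.succAbove k)

/-- A 5-tuple is admissible if all its 4-subtuples are admissible. -/
def Admissible5 {X : Type*} (P : Fin 5 → X) : Prop :=
  ∀ i, Admissible4 (del P i)

/-- The codifferential `δM` of a sub-Möbius structure: `δM(P)_i = M(P_i)`. -/
noncomputable def deltaM {X : Type*} (S : SubMoebius X) (P : Fin 5 → X) :
    Fin 5 → Fin 3 → EReal :=
  fun i => S.M (del P i)

/-- The canonical representation `η₅` acting on `5 × 3` matrices with entries in
`[−∞,∞]` (the space `L̄₅`): `η₅(π)(e_i ⊗ u) = e_{π(i)} ⊗ η₄(π_i)(u)`, where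
`η₄(σ) = sign(σ) φ(σ)` acts by signed coordinate permutations. -/
noncomputable def eta5E (π : Equiv.Perm (Fin 5)) (w : Fin 5 → Fin 3 → EReal) :
    Fin 5 → Fin 3 → EReal :=
  fun i =>
    signedAct3 (Equiv.Perm.sign (inducedPerm π (π⁻¹ i))) (phi (inducedPerm π (π⁻¹ i)))
      (w (π⁻¹ i))

/-- The subset `L₅ = W⁵ ⊗ L₄` of matrices all of whose rows lie in `L₄`. -/
def L5E : Set (Fin 5 → Fin 3 → EReal) := {w | ∀ i, w i ∈ L4set}

/-- Coefficient matrices of the ten characteristic functionals `r_λ`, `λ` an edge of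
`{1,…,5}` (0-indexed: rows `1,…,5` become `0,…,4`, columns `(a,b,c)` become `(0,1,2)`).
`rc p q` is the coefficient matrix of `r_{(p+1)(q+1)}` for `p < q`, and `0` otherwise. -/
def rc : Fin 5 → Fin 5 → Fin 5 → Fin 3 → ℝ :=
  -- r₁₂ = −a₃+a₄−a₅, r₁₃ = −a₂−b₄+b₅, r₁₄ = b₂−b₃−c₅, r₁₅ = −c₂+c₃−c₄,
  -- r₂₃ = −a₁+c₄−c₅, r₂₄ = b₁+c₃+b₅, r₂₅ = −c₁−b₃+b₄,
  -- r₃₄ = −c₁+c₂−a₅, r₃₅ = b₁−b₂−a₄, r₄₅ = −a₁+a₂−a₃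
  ![![0,
     ![![0,0,0], ![0,0,0], ![-1,0,0], ![1,0,0], ![-1,0,0]],
     ![![0,0,0], ![-1,0,0], ![0,0,0], ![0,-1,0], ![0,1,0]],
     ![![0,0,0], ![0,1,0], ![0,-1,0], ![0,0,0], ![0,0,-1]],
     ![![0,0,0], ![0,0,-1], ![0,0,1], ![0,0,-1], ![0,0,0]]],
    ![0, 0,
     ![![-1,0,0], ![0,0,0], ![0,0,0], ![0,0,1], ![0,0,-1]],
     ![![0,1,0], ![0,0,0], ![0,0,1], ![0,0,0], ![0,1,0]],
     ![![0,0,-1], ![0,0,0], ![0,-1,0], ![0,1,0], ![0,0,0]]],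
    ![0, 0, 0,
     ![![0,0,-1], ![0,0,1], ![0,0,0], ![0,0,0], ![-1,0,0]],
     ![![0,1,0], ![0,-1,0], ![0,0,0], ![-1,0,0], ![0,0,0]]],
    ![0, 0, 0, 0,
     ![![-1,0,0], ![1,0,0], ![-1,0,0], ![0,0,0], ![0,0,0]]],
    ![0, 0, 0, 0, 0]]

/-- The characteristic functional `r_λ : V⁵ → ℝ` for the edge `λ = {p,q}`, `p < q`. -/
def rfun (p q : Fin 5) (v : Fin 5 → Fin 3 → ℝ) : ℝ :=
  ∑ i, ∑ j, rc p q i j * v i j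

/-- The subspace `L₅ ⊂ V⁵` of `5 × 3` matrices whose rows sum to zero. -/
def L5sub : Submodule ℝ (Fin 5 → Fin 3 → ℝ) where
  carrier := {v | ∀ i, v i 0 + v i 1 + v i 2 = 0}
  zero_mem' := by intro i; simp
  add_mem' := by
    intro a b ha hb i
    have h1 := ha i; have h2 := hb i
    simp only [Pi.add_apply]; linarith
  smul_mem' := by
    intro c a ha i
    simp only [Pi.smul_apply, smul_eq_mul]
    linear_combination c * ha i

/-- The characteristic functional `r_λ` as a linear functional on `V⁵`. -/
def rlin (p q : Fin 5) : (Fin 5 → Fin 3 → ℝ) →ₗ[ℝ] ℝ where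
  toFun := fun v => ∑ i, ∑ j, rc p q i j * v i j
  map_add' := by
    intro v w
    rw [← Finset.sum_add_distrib]
    refine Finset.sum_congr rfl fun i _ => ?_
    rw [← Finset.sum_add_distrib]
    exact Finset.sum_congr rfl fun j _ => by simp [mul_add]
  map_smul' := by
    intro c v
    simp only [RingHom.id_apply, Pi.smul_apply, smul_eq_mul, Finset.mul_sum]
    exact Finset.sum_congr rfl fun i _ => Finset.sum_congr rfl fun j _ => by ring

/-- The symmetry set `R̂ = ⋂_{λ ∈ Λ} {v ∈ L₅ : r_λ(v) = 0}`, a subspace of `L₅`. -/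
def Rhat : Submodule ℝ (Fin 5 → Fin 3 → ℝ) :=
  L5sub ⊓ ⨅ (p : Fin 5), ⨅ (q : Fin 5), ⨅ (_ : p < q), LinearMap.ker (rlin p q)

/-- Coercion of a real `5 × 3` matrix to a matrix with entries in `[−∞,∞]`. -/
def toE (v : Fin 5 → Fin 3 → ℝ) : Fin 5 → Fin 3 → EReal := fun i j => (v i j : EReal)



def cc (j : Fin 3) (a b : Fin 4) : ℤ :=
  if a = b then 0
  else if (xor4 a b).val = (j + 2).val + 1 then 1
  else if (xor4 a b).val = (j + 1).val + 1 then -1 else 0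

/-- The index of the pair partition containing the pair `{p, q}`. -/
def pairIdx (p q : Fin 4) : Fin 3 :=
  ⟨(xor4 p q).val - 1, by have h := (xor4 p q).isLt; omega⟩

lemma pairIdx_swap : ∀ x y p q : Fin 4, p ≠ q →
    pairIdx (swap x y p) (swap x y q) = phiFun (swap x y) (pairIdx p q) := by
  decide +kernel

lemma cc_swap : ∀ x y : Fin 4, x ≠ y → ∀ (j : Fin 3) (a b : Fin 4),
    cc (phiFun (swap x y) j) (swap x y a) (swap x y b) = - cc j a b := by
  decide +kernel

lemma phiFun_one : ∀ j, phiFun 1 j = j := by decide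

lemma phiFun_swap_mul (x y : Fin 4) (π : Perm (Fin 4)) (j : Fin 3) :
    phiFun (swap x y * π) j = phiFun (swap x y) (phiFun π j) := by
  have h : π 0 ≠ π ⟨j.val + 1, by omega⟩ := by
    intro h
    have := congrArg Fin.val (π.injective h)
    simp at this
  exact pairIdx_swap x y _ _ h

lemma cc_equiv_aux (π : Perm (Fin 4)) : ∀ (j : Fin 3) (a b : Fin 4),
    cc (phiFun π j) (π a) (π b) = (Equiv.Perm.sign π : ℤ) * cc j a b := by
  induction π using Equiv.Perm.swap_induction_on with
  | one => intro j a b; simp [phiFun_one]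
  | swap_mul π x y hxy ih =>
    intro j a b
    rw [phiFun_swap_mul, Equiv.Perm.mul_apply, Equiv.Perm.mul_apply, cc_swap x y hxy, ih,
      Equiv.Perm.sign_mul, Equiv.Perm.sign_swap hxy]
    simp

lemma cc_equiv (π : Perm (Fin 4)) (j : Fin 3) (a b : Fin 4) :
    cc j (π a) (π b) = (Equiv.Perm.sign π : ℤ) * cc ((phi π)⁻¹ j) a b := by
  have hj : phiFun π ((phi π)⁻¹ j) = j := (phi π).apply_symm_apply j
  have := cc_equiv_aux π ((phi π)⁻¹ j) a b
  rwa [hj] at this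

/-- The map from edge functions to matrices of (doubled) cross-differences. -/
noncomputable def DD : (Fin 5 → Fin 5 → ℝ) →ₗ[ℝ] (Fin 5 → Fin 3 → ℝ) where
  toFun := fun G i j => ∑ a, ∑ b, (cc j a b : ℝ) * G (i.succAbove a) (i.succAbove b)
  map_add' := by
    intro G H; funext i j
    simp [mul_add, Finset.sum_add_distrib]
  map_smul' := by
    intro c G; funext i j
    simp only [RingHom.id_apply, Pi.smul_apply, smul_eq_mul, Finset.mul_sum]
    exact Finset.sum_congr rfl fun i _ => Finset.sum_congr rfl fun j _ => by ring

lemma succAbove_induced (π : Perm (Fin 5)) (i : Fin 5) (a : Fin 4) :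
    (π i).succAbove (inducedPerm π i a) = π (i.succAbove a) := by
  have h : finSuccAboveEquiv (π i) (inducedPerm π i a) = restrictPerm π i (finSuccAboveEquiv i a) := by
    simp [inducedPerm]
  have := congrArg Subtype.val h
  simpa [restrictPerm, finSuccAboveEquiv_apply] using this

lemma eta5_DD (π : Perm (Fin 5)) (G : Fin 5 → Fin 5 → ℝ) :
    eta5lin π (DD G) = DD (fun a b => G (π⁻¹ a) (π⁻¹ b)) := by
  funext i j
  obtain ⟨k, rfl⟩ := π.surjective i
  show eta5fun π (DD G) (π k) j = _
  have hk : π⁻¹ (π k) = k := π.symm_apply_apply k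
  simp only [eta5fun, eta4fun, DD, LinearMap.coe_mk, AddHom.coe_mk, hk]
  set σ := inducedPerm π k with hσ
  rw [← Equiv.sum_comp σ (fun a => ∑ b, (cc j a b : ℝ) * G (π⁻¹ ((π k).succAbove a)) (π⁻¹ ((π k).succAbove b)))]
  rw [Finset.mul_sum]
  refine Finset.sum_congr rfl fun a _ => ?_
  rw [← Equiv.sum_comp σ (fun b => (cc j (σ a) b : ℝ) * G (π⁻¹ ((π k).succAbove (σ a))) (π⁻¹ ((π k).succAbove b)))]
  rw [Finset.mul_sum]
  refine Finset.sum_congr rfl fun b _ => ?_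
  rw [cc_equiv, hσ, succAbove_induced, succAbove_induced]
  have hs : ∀ x, π⁻¹ (π x) = x := π.symm_apply_apply
  simp [mul_assoc, hs]

lemma DD_expl (G : Fin 5 → Fin 5 → ℝ) (i : Fin 5) :
    DD G i = ![ (G (i.succAbove 0) (i.succAbove 3) + G (i.succAbove 3) (i.succAbove 0)
        + G (i.succAbove 1) (i.succAbove 2) + G (i.succAbove 2) (i.succAbove 1))
        - (G (i.succAbove 0) (i.succAbove 2) + G (i.succAbove 2) (i.succAbove 0)
        + G (i.succAbove 1) (i.succAbove 3) + G (i.succAbove 3) (i.succAbove 1)),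
       (G (i.succAbove 0) (i.succAbove 1) + G (i.succAbove 1) (i.succAbove 0)
        + G (i.succAbove 2) (i.succAbove 3) + G (i.succAbove 3) (i.succAbove 2))
        - (G (i.succAbove 0) (i.succAbove 3) + G (i.succAbove 3) (i.succAbove 0)
        + G (i.succAbove 1) (i.succAbove 2) + G (i.succAbove 2) (i.succAbove 1)),
       (G (i.succAbove 0) (i.succAbove 2) + G (i.succAbove 2) (i.succAbove 0)
        + G (i.succAbove 1) (i.succAbove 3) + G (i.succAbove 3) (i.succAbove 1))
        - (G (i.succAbove 0) (i.succAbove 1) + G (i.succAbove 1) (i.succAbove 0)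
        + G (i.succAbove 2) (i.succAbove 3) + G (i.succAbove 3) (i.succAbove 2))] := by
  funext j
  fin_cases j <;> simp [DD, Fin.sum_univ_four, cc, xor4] <;> ring

lemma mem_Rhat (v : Fin 5 → Fin 3 → ℝ) : v ∈ Rhat ↔
    (∀ i, v i 0 + v i 1 + v i 2 = 0) ∧
    (-v 2 0 + v 3 0 - v 4 0 = 0 ∧ -v 1 0 - v 3 1 + v 4 1 = 0 ∧ v 1 1 - v 2 1 - v 4 2 = 0 ∧
     -v 1 2 + v 2 2 - v 3 2 = 0 ∧ -v 0 0 + v 3 2 - v 4 2 = 0 ∧ v 0 1 + v 2 2 + v 4 1 = 0 ∧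
     -v 0 2 - v 2 1 + v 3 1 = 0 ∧ -v 0 2 + v 1 2 - v 4 0 = 0 ∧ v 0 1 - v 1 1 - v 3 0 = 0 ∧
     -v 0 0 + v 1 0 - v 2 0 = 0) := by
  rw [Rhat, Submodule.mem_inf]
  refine and_congr Iff.rfl ?_
  simp only [Submodule.mem_iInf, LinearMap.mem_ker, rlin, LinearMap.coe_mk, AddHom.coe_mk]
  simp only [Fin.forall_fin_succ, Fin.sum_univ_succ]
  simp [rc, Fin.lt_def, Fin.succ]
  constructor <;> intro h <;> (repeat' apply And.intro) <;> linarith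


lemma DD_mem (G : Fin 5 → Fin 5 → ℝ) : DD G ∈ Rhat := by
  rw [mem_Rhat]
  refine ⟨fun i => ?_, ?_⟩
  · rw [DD_expl]; simp
  · simp only [DD_expl]
    simp [Fin.succAbove, Fin.lt_def]
    (repeat' apply And.intro) <;> ring

/-- Normalised edge functions. -/
def gg : (Fin 5 → ℝ) →ₗ[ℝ] (Fin 5 → Fin 5 → ℝ) where
  toFun := fun t => ![![0, 0, t 0, t 1, 0], ![0, 0, t 2, t 3, 0], ![0, 0, 0, t 4, 0], 0, 0]
  map_add' := by
    intro s t; funext i j; fin_cases i <;> fin_cases j <;> simp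
  map_smul' := by
    intro s t; funext i j; fin_cases i <;> fin_cases j <;> simp

/-- Coordinates on `Rhat`. -/
def ll : (Fin 5 → Fin 3 → ℝ) →ₗ[ℝ] (Fin 5 → ℝ) where
  toFun := fun v => ![v 3 2, v 2 2, -v 3 1, -v 2 1, v 1 0 + v 2 2]
  map_add' := by
    intro s t; funext i; fin_cases i <;> simp <;> ring
  map_smul' := by
    intro s t; funext i; fin_cases i <;> simp <;> ring

lemma gg_apply (t : Fin 5 → ℝ) : gg t =
  ![![0, 0, t 0, t 1, 0], ![0, 0, t 2, t 3, 0], ![0, 0, 0, t 4, 0], 0, 0] := rfl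

lemma ll_apply (v : Fin 5 → Fin 3 → ℝ) : ll v =
  ![v 3 2, v 2 2, -v 3 1, -v 2 1, v 1 0 + v 2 2] := rfl

lemma ll_DD (G : Fin 5 → Fin 5 → ℝ) : ll (DD G) =
    ![DD G 3 2, DD G 2 2, -DD G 3 1, -DD G 2 1, DD G 1 0 + DD G 2 2] := rfl

lemma ll_DD_gg (t : Fin 5 → ℝ) : ll (DD (gg t)) = t := by
  rw [ll_DD]
  simp only [DD_expl, gg_apply]
  funext k
  fin_cases k <;> simp [Fin.succAbove, Fin.lt_def]

lemma DD_gg_ll (v : Fin 5 → Fin 3 → ℝ) (hv : v ∈ Rhat) : DD (gg (ll v)) = v := by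
  rw [mem_Rhat] at hv
  obtain ⟨h, h1, h2, h3, h4, h5, h6, h7, h8, h9, h10⟩ := hv
  have e0 := h 0
  have e1 := h 1
  have e2 := h 2
  have e3 := h 3
  have e4 := h 4
  funext i
  rw [DD_expl, gg_apply, ll_apply]
  funext j
  fin_cases i <;> fin_cases j <;> simp [Fin.succAbove, Fin.lt_def] <;> linarith

noncomputable def RE : Rhat ≃ₗ[ℝ] (Fin 5 → ℝ) where
  toFun := fun v => ll v.1
  map_add' := by intro v w; simp
  map_smul' := by intro v w; simp
  invFun := fun t => ⟨DD (gg t), DD_mem _⟩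
  left_inv := by
    rintro ⟨v, hv⟩
    exact Subtype.ext (DD_gg_ll v hv)
  right_inv := fun t => ll_DD_gg t

lemma Rhat_inv (π : Equiv.Perm (Fin 5)) (v : Fin 5 → Fin 3 → ℝ) (hv : v ∈ Rhat) :
    eta5lin π v ∈ Rhat := by
  rw [← DD_gg_ll v hv, eta5_DD]
  exact DD_mem _

lemma Rhat_finrank : Module.finrank ℝ Rhat = 5 := by
  rw [RE.finrank_eq]; simp

lemma Rhat_trace (π : Equiv.Perm (Fin 5)) (hπ : π.cycleType = {2})
    (h : ∀ v ∈ Rhat, eta5lin π v ∈ Rhat) :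
    LinearMap.trace ℝ Rhat ((eta5lin π).restrict h) = 1 := by
  have hs : π.IsSwap := by
    rw [← Equiv.Perm.card_support_eq_two, ← Equiv.Perm.sum_cycleType, hπ]; simp
  obtain ⟨x, y, hxy, rfl⟩ := hs
  rw [← LinearMap.trace_conj' _ RE, LinearMap.trace_eq_matrix_trace ℝ (Pi.basisFun ℝ (Fin 5)),
    Matrix.trace]
  have key : ∀ k : Fin 5, Matrix.diag (LinearMap.toMatrix (Pi.basisFun ℝ (Fin 5))
      (Pi.basisFun ℝ (Fin 5)) (RE.conj ((eta5lin (swap x y)).restrict h))) k =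
      ll (DD (fun a b => gg (Pi.single k 1) (swap x y a) (swap x y b))) k := by
    intro k
    rw [Matrix.diag_apply, LinearMap.toMatrix_apply]
    simp only [Pi.basisFun_apply, Pi.basisFun_repr, LinearEquiv.conj_apply_apply]
    have : ((eta5lin (swap x y)).restrict h) (RE.symm (Pi.single k 1)) =
      ⟨eta5lin (swap x y) (DD (gg (Pi.single k 1))), h _ (DD_mem _)⟩ := rfl
    rw [this]
    show ll (eta5lin (swap x y) (DD (gg (Pi.single k 1)))) k = _
    rw [eta5_DD, Equiv.swap_inv]
  rw [Finset.sum_congr rfl fun k _ => key k]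
  simp only [Fin.sum_univ_five, ll_DD, DD_expl, gg_apply]
  fin_cases x <;> fin_cases y <;>
    first
    | exact absurd rfl hxy
    | simp [Fin.succAbove, Fin.lt_def, Equiv.swap_apply_def, Pi.single_apply]

set_option maxHeartbeats 1000000 in
lemma Rhat_irred (W : Submodule ℝ (Fin 5 → Fin 3 → ℝ)) (hW : W ≤ Rhat)
    (hinv : ∀ π : Equiv.Perm (Fin 5), ∀ v ∈ W, eta5lin π v ∈ W) : W = ⊥ ∨ W = Rhat := by
  have inv : ∀ (π : Equiv.Perm (Fin 5)) (G : Fin 5 → Fin 5 → ℝ), DD G ∈ W →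
      DD (fun a b => G (π a) (π b)) ∈ W := by
    intro π G hG
    have := hinv π⁻¹ _ hG
    rwa [eta5_DD, inv_inv] at this
  by_cases H : ∀ G, DD G ∈ W → DD G 4 0 = 0
  · left
    have H1 : ∀ G, DD G ∈ W → DD G 4 1 = 0 := by
      intro G hG
      have := H _ (inv (swap 1 2) G hG)
      simp only [DD_expl] at this ⊢
      simp [Fin.succAbove, Fin.lt_def, Equiv.swap_apply_def] at this ⊢
      linarith
    rw [Submodule.eq_bot_iff]
    intro v hv
    have hv' := DD_gg_ll v (hW hv)
    have hG : DD (gg (ll v)) ∈ W := by rw [hv']; exact hv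
    rw [← hv']
    generalize gg (ll v) = G at hG
    funext i j
    have k0 := H _ (inv (swap i 4) G hG)
    have k1 := H1 _ (inv (swap i 4) G hG)
    show DD G i j = 0
    simp only [DD_expl] at k0 k1 ⊢
    fin_cases i <;>
      simp [Fin.succAbove, Fin.lt_def, Equiv.swap_apply_def] at k0 k1 ⊢ <;>
      fin_cases j <;> simp <;> linarith
  · right
    push Not at H
    obtain ⟨G, hG, hne⟩ := H
    have hE : DD (gg ![-1, 1, 1, -1, 0]) ∈ W := by
      have m1 := inv (swap 0 1) G hG
      have m2 := inv (swap 2 3) G hG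
      have m3 := inv (swap 0 1 * swap 2 3) G hG
      have m4 := W.smul_mem (DD G 4 0)⁻¹ (W.add_mem (W.sub_mem (W.sub_mem hG m1) m2) m3)
      convert m4 using 1
      rw [eq_inv_smul_iff₀ hne]
      funext i j
      simp only [Pi.smul_apply, Pi.add_apply, Pi.sub_apply, smul_eq_mul]
      simp only [DD_expl, gg_apply]
      fin_cases i <;> fin_cases j <;>
        simp [Fin.succAbove, Fin.lt_def, Equiv.swap_apply_def] <;> ring
    refine le_antisymm hW ?_
    intro v hv
    rw [← DD_gg_ll v hv]
    generalize ll v = t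
    have m1 := inv (swap 0 2) _ hE
    have m2 := inv (swap 0 4) _ hE
    have m3 := inv (swap 2 4) _ hE
    have m4 := inv (swap 0 2 * swap 0 4) _ hE
    have m := W.add_mem (W.add_mem (W.add_mem (W.add_mem
      (W.smul_mem (-t 0 / 3 + t 1 / 3 + t 2 / 3) hE)
      (W.smul_mem ((-t 0 - t 1 - t 2 - t 3 + t 4) / 6) m1))
      (W.smul_mem ((t 0 - t 1 + t 2 - t 3 - t 4) / 6) m2))
      (W.smul_mem ((t 0 + t 1 - t 2 - t 3 - t 4) / 6) m3))
      (W.smul_mem (t 4 / 3) m4)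
    convert m using 1
    funext i j
    simp only [Pi.smul_apply, Pi.add_apply, smul_eq_mul]
    simp only [DD_expl, gg_apply]
    fin_cases i <;> fin_cases j <;>
      simp [Fin.succAbove, Fin.lt_def, Equiv.swap_apply_def] <;> ring

set_option linter.unusedSimpArgs false
lemma realize {X : Type*} (A : X → X → X → X → ℝ)
    (h1 : ∀ x y z w, A y x z w = -A x y z w)
    (h2 : ∀ x y z w, A x y w z = -A x y z w)
    (h3 : ∀ x y z w, A z w x y = A x y z w)
    (hcyc : ∀ x y z w, A x y z w + A y z x w + A z x y w = 0)
    (hcoc : ∀ x y z w v, x ≠ y → x ≠ z → x ≠ w → x ≠ v → y ≠ z → y ≠ w → y ≠ v →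
      A x y z w + A x y w v = A x y z v) :
    ∃ G : X → X → ℝ, (∀ x y, G x y = G y x) ∧
      ∀ x y z w, x ≠ y → x ≠ z → x ≠ w → y ≠ z → y ≠ w → z ≠ w →
        A x y z w = G x w + G y z - G x z - G y w := by
  classical
  by_cases hex : ∃ ω o u : X, ω ≠ o ∧ ω ≠ u ∧ o ≠ u
  swap
  · refine ⟨fun _ _ => 0, fun _ _ => rfl, ?_⟩
    intro x y z w hxy hxz _ hyz
    exact absurd ⟨x, y, z, hxy, hxz, hyz⟩ hex
  obtain ⟨ω, o, u, hωo, hωu, hou⟩ := hex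
  have hdeg : ∀ x z w, A x x z w = 0 := fun x z w => by have := h1 x x z w; linarith
  have hcoc1 : ∀ x y v z w, z ≠ w → z ≠ x → z ≠ y → z ≠ v → w ≠ x → w ≠ y → w ≠ v →
      A x y z w + A y v z w = A x v z w := by
    intro x y v z w a b c d e f g
    have := hcoc z w x y v a b c d e f g
    rwa [h3 x y z w, h3 y v z w, h3 x v z w] at this
  let g0 : X → X → ℝ := fun x y => if y = o then A u x o ω else A u y o ω + A o x y ω
  have g0o : ∀ x, g0 x o = A u x o ω := fun x => by simp [g0]
  have g0n : ∀ x y, y ≠ o → g0 x y = A u y o ω + A o x y ω := fun x y h => by simp [g0, h]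
  have g0s : ∀ x y, x ≠ ω → y ≠ ω → g0 x y = g0 y x := by
    intro x y hx hy
    by_cases hxo : x = o
    · subst hxo
      by_cases hyo : y = x
      · subst hyo; rfl
      · rw [g0o, g0n _ _ hyo, hdeg]; ring
    · by_cases hyo : y = o
      · subst hyo
        rw [g0o, g0n _ _ hxo, hdeg]; ring
      · rw [g0n _ _ hxo, g0n _ _ hyo]
        have c := hcoc1 x u y o ω hωo.symm (Ne.symm hxo) hou (Ne.symm hyo) (Ne.symm hx) hωu
          (Ne.symm hy)
        have c2 := hcyc x y o ω
        have c3 := h1 u x o ω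
        have c4 := h1 o y x ω
        linarith
  let G : X → X → ℝ := fun x y => if x = ω ∨ y = ω then 0 else g0 x y
  have Gω : ∀ x, G x ω = 0 := fun x => by simp [G]
  have Gω' : ∀ x, G ω x = 0 := fun x => by simp [G]
  have Gn : ∀ x y, x ≠ ω → y ≠ ω → G x y = g0 x y := fun x y hx hy => by simp [G, hx, hy]
  have Gs : ∀ x y, G x y = G y x := by
    intro x y
    by_cases hx : x = ω
    · subst hx; rw [Gω, Gω']
    by_cases hy : y = ω
    · subst hy; rw [Gω, Gω']
    rw [Gn _ _ hx hy, Gn _ _ hy hx, g0s _ _ hx hy]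
  have key : ∀ x y z, x ≠ ω → y ≠ ω → z ≠ ω → x ≠ y → x ≠ z → y ≠ z →
      A x y z ω = G y z - G x z := by
    intro x y z hx hy hz hxy hxz hyz
    rw [Gn _ _ hy hz, Gn _ _ hx hz]
    by_cases hzo : z = o
    · subst hzo
      rw [g0o, g0o]
      have c := hcoc1 x u y z ω hωo.symm (Ne.symm hxz) hou (Ne.symm hyz) (Ne.symm hx) hωu
          (Ne.symm hy)
      have := h1 u x z ω
      linarith
    · rw [g0n _ _ hzo, g0n _ _ hzo]
      have c := hcoc1 x o y z ω hz (Ne.symm hxz) hzo (Ne.symm hyz) (Ne.symm hx) hωo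
          (Ne.symm hy)
      have := h1 o x z ω
      linarith
  refine ⟨G, Gs, ?_⟩
  intro x y z w hxy hxz hxw hyz hyw hzw
  by_cases hw : w = ω
  · subst hw
    rw [key x y z hxw hyw hzw hxy hxz hyz, Gω, Gω]; ring
  by_cases hz : z = ω
  · subst hz
    rw [h2, key x y w hxz hyz hw hxy hxw hyw, Gω, Gω]; ring
  by_cases hy : y = ω
  · subst hy
    rw [h3, key z w x hz hw hxy hzw (Ne.symm hxz) (Ne.symm hxw), Gω', Gω', Gs w x, Gs z x]; ring
  by_cases hx : x = ω
  · subst hx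
    rw [← h3, h2, key z w y hz hw hy hzw (Ne.symm hyz) (Ne.symm hyw), Gω', Gω', Gs w y, Gs z y]
    ring
  have c := hcoc x y z ω w hxy hxz hx hxw hyz hy hyw
  have c2 := h2 x y w ω
  have k1 := key x y z hx hy hz hxy hxz hyz
  have k2 := key x y w hx hy hw hxy hxw hyw
  linarith

lemma cd2_coe (p q : ℝ) : cd2 (p : EReal) q = ((p - q : ℝ) : EReal) := by
  simp [cd2]

lemma cd4_coe (p q r s : ℝ) : cd4 (p : EReal) q r s = ((p + q - r - s : ℝ) : EReal) := by
  rw [sub_sub]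
  simp [cd4]

lemma cd4_pr (q s : ℝ) : cd4 ⊥ (q : EReal) ⊥ s = ((q - s : ℝ) : EReal) := by
  simp [cd4, cd2_coe]
lemma cd4_ps (q s : ℝ) : cd4 ⊥ (q : EReal) s ⊥ = ((q - s : ℝ) : EReal) := by
  simp [cd4, cd2_coe]
lemma cd4_qr (q s : ℝ) : cd4 (q : EReal) ⊥ ⊥ s = ((q - s : ℝ) : EReal) := by
  simp [cd4, cd2_coe]
lemma cd4_qs (q s : ℝ) : cd4 (q : EReal) ⊥ s ⊥ = ((q - s : ℝ) : EReal) := by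
  simp [cd4, cd2_coe]

lemma cd4_top1 (q : EReal) (r s : ℝ) (hq : q ≠ ⊥) : cd4 ⊤ q r s = ⊤ := by
  induction q
  · exact absurd rfl hq
  · simp [cd4, sub_eq_add_neg, ← EReal.coe_add, ← EReal.coe_neg]
  · simp [cd4, sub_eq_add_neg, ← EReal.coe_add, ← EReal.coe_neg]
lemma cd4_top2 (q : EReal) (r s : ℝ) (hq : q ≠ ⊥) : cd4 q ⊤ r s = ⊤ := by
  induction q
  · exact absurd rfl hq
  · simp [cd4, sub_eq_add_neg, ← EReal.coe_add, ← EReal.coe_neg]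
  · simp [cd4, sub_eq_add_neg, ← EReal.coe_add, ← EReal.coe_neg]
lemma cd4_top3 (q : EReal) (r s : ℝ) (hq : q ≠ ⊥) : cd4 r s ⊤ q = ⊥ := by
  induction q
  · exact absurd rfl hq
  · simp [cd4, sub_eq_add_neg, ← EReal.coe_add, ← EReal.coe_neg]
  · simp [cd4, sub_eq_add_neg, ← EReal.coe_add, ← EReal.coe_neg]
lemma cd4_top4 (q : EReal) (r s : ℝ) (hq : q ≠ ⊥) : cd4 r s q ⊤ = ⊥ := by
  induction q
  · exact absurd rfl hq
  · simp [cd4, sub_eq_add_neg, ← EReal.coe_add, ← EReal.coe_neg]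
  · simp [cd4, sub_eq_add_neg, ← EReal.coe_add, ← EReal.coe_neg]

lemma adm_of_inj {X : Type*} {Q : Fin 4 → X} (h : Function.Injective Q) : Admissible4 Q :=
  fun _ _ _ hij _ _ hh => hij (h hh.1)

/-- real cross-difference triple -/
def cr3 {X : Type*} (G : X → X → ℝ) (Q : Fin 4 → X) : Fin 3 → ℝ :=
  ![G (Q 0) (Q 3) + G (Q 1) (Q 2) - G (Q 0) (Q 2) - G (Q 1) (Q 3),
    G (Q 0) (Q 1) + G (Q 2) (Q 3) - G (Q 0) (Q 3) - G (Q 1) (Q 2),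
    G (Q 1) (Q 3) + G (Q 0) (Q 2) - G (Q 0) (Q 1) - G (Q 2) (Q 3)]

lemma Md_inj {X : Type*} (m : SemiMetric X) : ∃ G : X → X → ℝ, (∀ x y, G x y = G y x) ∧
    ∀ Q : Fin 4 → X, Function.Injective Q → ∀ j, Md m Q j = (cr3 G Q j : EReal) := by
  classical
  obtain ⟨T, hT, hrem⟩ := m.remote
  let G : X → X → ℝ := fun x y => if x ∈ T ∨ y ∈ T then 0 else (ip m x y).toReal
  have ips : ∀ x y, ip m x y = ip m y x := fun x y => by rw [ip, ip, m.symm]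
  have hfin : ∀ x y, x ≠ y → x ∉ T → y ∉ T → ip m x y = (G x y : EReal) := by
    intro x y hxy hx hy
    have h1 : m.d x y ≠ ⊤ := fun h => by
      have := (hrem x y hxy).1 h; tauto
    have h0 : m.d x y ≠ 0 := fun h => hxy ((m.eq_zero_iff x y).1 h)
    have : G x y = (ip m x y).toReal := by simp [G, hx, hy]
    rw [this, EReal.coe_toReal]
    · simpa [ip] using h0
    · simpa [ip] using h1
  have hbot : ∀ x y, x ≠ y → x ∈ T ∨ y ∈ T → ip m x y = ⊥ := by
    intro x y hxy h
    have h1 := (hrem x y hxy).2 h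
    simp [ip, h1]
  have G0 : ∀ x y, x ∈ T ∨ y ∈ T → G x y = 0 := fun x y h => by simp [G, h]
  refine ⟨G, fun x y => by simp only [G, ips x y, or_comm], ?_⟩
  intro Q hQ j
  have n01 : Q 0 ≠ Q 1 := fun h => absurd (hQ h) (by decide)
  have n02 : Q 0 ≠ Q 2 := fun h => absurd (hQ h) (by decide)
  have n03 : Q 0 ≠ Q 3 := fun h => absurd (hQ h) (by decide)
  have n12 : Q 1 ≠ Q 2 := fun h => absurd (hQ h) (by decide)
  have n13 : Q 1 ≠ Q 3 := fun h => absurd (hQ h) (by decide)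
  have n23 : Q 2 ≠ Q 3 := fun h => absurd (hQ h) (by decide)
  have nn : ∀ x y, x ≠ y → x ∈ T → y ∉ T := fun x y h hx hy => h (hT hx hy)
  by_cases t0 : Q 0 ∈ T
  · have t1 := nn _ _ n01 t0
    have t2 := nn _ _ n02 t0
    have t3 := nn _ _ n03 t0
    fin_cases j <;> simp [Md, cr3, hbot, G0, hfin, *, cd4_pr, cd4_ps, cd4_qr, cd4_qs, -EReal.coe_sub, -EReal.coe_add]
  by_cases t1 : Q 1 ∈ T
  · have t2 := nn _ _ n12 t1
    have t3 := nn _ _ n13 t1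
    fin_cases j <;> simp [Md, cr3, hbot, G0, hfin, *, cd4_pr, cd4_ps, cd4_qr, cd4_qs, -EReal.coe_sub, -EReal.coe_add]
  by_cases t2 : Q 2 ∈ T
  · have t3 := nn _ _ n23 t2
    fin_cases j <;> simp [Md, cr3, hbot, G0, hfin, *, cd4_pr, cd4_ps, cd4_qr, cd4_qs, -EReal.coe_sub, -EReal.coe_add]
  by_cases t3 : Q 3 ∈ T
  · fin_cases j <;> simp [Md, cr3, hbot, G0, hfin, *, cd4_pr, cd4_ps, cd4_qr, cd4_qs, -EReal.coe_sub, -EReal.coe_add]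
  · fin_cases j <;> simp [Md, cr3, hbot, G0, hfin, *, cd4_coe, -EReal.coe_sub, -EReal.coe_add]

lemma moebius_forward {X : Type*} (S : SubMoebius X) (h : IsMoebius S) (P : Fin 5 → X)
    (hP : Function.Injective P) : ∃ v ∈ Rhat, deltaM S P = toE v := by
  obtain ⟨m, hm⟩ := h
  obtain ⟨G, Gs, hG⟩ := Md_inj m
  refine ⟨DD (fun a b => 1 / 2 * G (P a) (P b)), DD_mem _, ?_⟩
  funext i j
  have hi : Function.Injective (del P i) := fun a b hab =>
    Fin.succAbove_right_injective (hP hab)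
  rw [deltaM, hm _ (adm_of_inj hi), hG _ hi, toE]
  congr 1
  rw [DD_expl, cr3]
  simp only [del]
  rw [Gs (P (i.succAbove 3)) (P (i.succAbove 0)), Gs (P (i.succAbove 3)) (P (i.succAbove 1)),
    Gs (P (i.succAbove 3)) (P (i.succAbove 2)), Gs (P (i.succAbove 2)) (P (i.succAbove 0)),
    Gs (P (i.succAbove 2)) (P (i.succAbove 1)), Gs (P (i.succAbove 1)) (P (i.succAbove 0))]
  fin_cases j <;> simp <;> ring

/-- the metric from real Gromov products -/
noncomputable def mkMetric {X : Type*} (G : X → X → ℝ) (Gs : ∀ x y, G x y = G y x) :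
    SemiMetric X where
  d := open Classical in fun x y => if x = y then 0 else ENNReal.ofReal (Real.exp (-G x y))
  symm := fun x y => by
    by_cases h : x = y
    · simp [h]
    · simp [h, Ne.symm h, Gs x y]
  eq_zero_iff := fun x y => by
    by_cases h : x = y <;> simp [h, Real.exp_pos]
  remote := ⟨∅, Set.subsingleton_empty, fun x y h => by simp [h]⟩

lemma ip_self {X : Type*} (m : SemiMetric X) (x : X) : ip m x x = ⊤ := by
  simp [ip, (m.eq_zero_iff x x).2 rfl]

lemma ip_mk {X : Type*} (G : X → X → ℝ) (Gs : ∀ x y, G x y = G y x) (x y : X) (h : x ≠ y) :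
    ip (mkMetric G Gs) x y = (G x y : EReal) := by
  simp [ip, mkMetric, h, ENNReal.log_ofReal, Real.exp_pos, not_le.2 (Real.exp_pos _)]

lemma Md_mk_inj {X : Type*} (G : X → X → ℝ) (Gs : ∀ x y, G x y = G y x) (Q : Fin 4 → X)
    (hQ : Function.Injective Q) : Md (mkMetric G Gs) Q = fun j => (cr3 G Q j : EReal) := by
  have n01 : Q 0 ≠ Q 1 := fun h => absurd (hQ h) (by decide)
  have n02 : Q 0 ≠ Q 2 := fun h => absurd (hQ h) (by decide)
  have n03 : Q 0 ≠ Q 3 := fun h => absurd (hQ h) (by decide)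
  have n12 : Q 1 ≠ Q 2 := fun h => absurd (hQ h) (by decide)
  have n13 : Q 1 ≠ Q 3 := fun h => absurd (hQ h) (by decide)
  have n23 : Q 2 ≠ Q 3 := fun h => absurd (hQ h) (by decide)
  funext j
  fin_cases j <;> simp [Md, cr3, ip_mk, *, cd4_coe, -EReal.coe_sub, -EReal.coe_add]

lemma ip_mk_ne_bot {X : Type*} (G : X → X → ℝ) (Gs : ∀ x y, G x y = G y x) (x y : X) :
    ip (mkMetric G Gs) x y ≠ ⊥ := by
  by_cases h : x = y
  · subst h; simp [ip_self]
  · simp [ip_mk, h]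

lemma Md_deg01 {X : Type*} (G : X → X → ℝ) (Gs : ∀ x y, G x y = G y x) (Q : Fin 4 → X)
    (n02 : Q 0 ≠ Q 2) (n03 : Q 0 ≠ Q 3) (n12 : Q 1 ≠ Q 2) (n13 : Q 1 ≠ Q 3)
    (h : Q 0 = Q 1 ∨ Q 2 = Q 3) : Md (mkMetric G Gs) Q = ![0, ⊤, ⊥] := by
  have hb := ip_mk_ne_bot G Gs
  simp only [Md, ip_mk G Gs _ _ n02, ip_mk G Gs _ _ n03, ip_mk G Gs _ _ n12,
    ip_mk G Gs _ _ n13, cd4_coe]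
  rcases h with h | h
  · rw [h, ip_self, cd4_top1 _ _ _ (hb _ _), cd4_top3 _ _ _ (hb _ _)]
    congr 1
    rw [← EReal.coe_zero]; congr 1; ring
  · rw [h, ip_self, cd4_top2 _ _ _ (hb _ _), cd4_top4 _ _ _ (hb _ _)]
    congr 1
    rw [← EReal.coe_zero]; congr 1; ring

lemma Md_deg02 {X : Type*} (G : X → X → ℝ) (Gs : ∀ x y, G x y = G y x) (Q : Fin 4 → X)
    (n01 : Q 0 ≠ Q 1) (n03 : Q 0 ≠ Q 3) (n12 : Q 1 ≠ Q 2) (n23 : Q 2 ≠ Q 3)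
    (h : Q 0 = Q 2 ∨ Q 1 = Q 3) : Md (mkMetric G Gs) Q = ![⊥, 0, ⊤] := by
  have hb := ip_mk_ne_bot G Gs
  simp only [Md, ip_mk G Gs _ _ n01, ip_mk G Gs _ _ n03, ip_mk G Gs _ _ n12,
    ip_mk G Gs _ _ n23, cd4_coe]
  rcases h with h | h
  · rw [h, ip_self, cd4_top2 _ _ _ (hb _ _), cd4_top3 _ _ _ (hb _ _), Gs (Q 1) (Q 2)]
    congr 2
    rw [← EReal.coe_zero]; congr 1; ring
  · rw [h, ip_self, cd4_top1 _ _ _ (hb _ _), cd4_top4 _ _ _ (hb _ _), Gs (Q 3) (Q 2)]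
    congr 2
    rw [← EReal.coe_zero]; congr 1; ring

lemma Md_deg03 {X : Type*} (G : X → X → ℝ) (Gs : ∀ x y, G x y = G y x) (Q : Fin 4 → X)
    (n01 : Q 0 ≠ Q 1) (n02 : Q 0 ≠ Q 2) (n13 : Q 1 ≠ Q 3) (n23 : Q 2 ≠ Q 3)
    (h : Q 0 = Q 3 ∨ Q 1 = Q 2) : Md (mkMetric G Gs) Q = ![⊤, ⊥, 0] := by
  have hb := ip_mk_ne_bot G Gs
  simp only [Md, ip_mk G Gs _ _ n01, ip_mk G Gs _ _ n02, ip_mk G Gs _ _ n13,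
    ip_mk G Gs _ _ n23, cd4_coe]
  rcases h with h | h
  · rw [h, ip_self, cd4_top1 _ _ _ (hb _ _), cd4_top3 _ _ _ (hb _ _), Gs (Q 1) (Q 3),
      Gs (Q 2) (Q 3)]
    congr 3
    rw [← EReal.coe_zero]; congr 1; ring
  · rw [h, ip_self, cd4_top2 _ _ _ (hb _ _), cd4_top4 _ _ _ (hb _ _)]
    congr 3
    rw [← EReal.coe_zero]; congr 1; ring

lemma adm_perm {X : Type*} {Q : Fin 4 → X} (h : Admissible4 Q) (π : Perm (Fin 4)) :
    Admissible4 (fun k => Q (π k)) := fun i j k hij hik hjk =>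
  h (π i) (π j) (π k) (π.injective.ne hij) (π.injective.ne hik) (π.injective.ne hjk)

lemma M_deg {X : Type*} (S : SubMoebius X) (Q : Fin 4 → X) (hQ : Admissible4 Q)
    (π : Perm (Fin 4)) (h : Q (π 0) = Q (π 1)) :
    S.M Q = signedAct3 (Equiv.Perm.sign π) (phi π) ![0, ⊤, ⊥] := by
  have ha := adm_perm hQ π
  have he := S.equivariant _ ha π
  have h1 : (fun k => Q (π (π⁻¹ k))) = Q := by
    funext k
    exact congrArg Q (π.apply_symm_apply k)
  have h2 : (fun k => Q (π k)) = ![Q (π 0), Q (π 0), Q (π 2), Q (π 3)] := by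
    funext k; fin_cases k <;> simp [h]
  rw [h1] at he
  rw [he]
  rw [h2] at ha ⊢
  rw [S.diag _ _ _ ha]

lemma sa_pos (π : Perm (Fin 4)) (p : Fin 3 → EReal) (a b c : Fin 3)
    (hs : Equiv.Perm.sign π = 1) (h0 : (phi π)⁻¹ 0 = a) (h1 : (phi π)⁻¹ 1 = b)
    (h2 : (phi π)⁻¹ 2 = c) : signedAct3 (Equiv.Perm.sign π) (phi π) p = ![p a, p b, p c] := by
  subst h0 h1 h2
  funext j; fin_cases j <;> simp [signedAct3, hs]

lemma sa_neg (π : Perm (Fin 4)) (p : Fin 3 → EReal) (a b c : Fin 3)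
    (hs : Equiv.Perm.sign π = -1) (h0 : (phi π)⁻¹ 0 = a) (h1 : (phi π)⁻¹ 1 = b)
    (h2 : (phi π)⁻¹ 2 = c) : signedAct3 (Equiv.Perm.sign π) (phi π) p = ![-p a, -p b, -p c] := by
  subst h0 h1 h2
  have : ¬ ((-1 : ℤˣ) = 1) := by decide
  funext j; fin_cases j <;> simp [signedAct3, hs, this]

lemma M_eq_Md_deg {X : Type*} (S : SubMoebius X) (G : X → X → ℝ) (Gs : ∀ x y, G x y = G y x)
    (Q : Fin 4 → X) (hQ : Admissible4 Q) (hn : ¬ Function.Injective Q) :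
    S.M Q = Md (mkMetric G Gs) Q := by
  have c012 := hQ 0 1 2 (by decide) (by decide) (by decide)
  have c013 := hQ 0 1 3 (by decide) (by decide) (by decide)
  have c023 := hQ 0 2 3 (by decide) (by decide) (by decide)
  have c123 := hQ 1 2 3 (by decide) (by decide) (by decide)
  have cases : Q 0 = Q 1 ∨ Q 2 = Q 3 ∨ Q 0 = Q 2 ∨ Q 1 = Q 3 ∨ Q 0 = Q 3 ∨ Q 1 = Q 2 := by
    by_contra hc
    push Not at hc
    obtain ⟨a, b, c, d, e, f⟩ := hc
    apply hn
    intro i j hij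
    by_contra hne
    fin_cases i <;> fin_cases j <;> simp_all [eq_comm]
  rcases cases with h | h | h | h | h | h
  · rw [M_deg S Q hQ 1 h, sa_pos 1 _ 0 1 2 (by decide) (by decide) (by decide) (by decide)]
    rw [Md_deg01 G Gs Q (by grind) (by grind) (by grind) (by grind) (by grind)]; simp
  · rw [M_deg S Q hQ (swap 0 2 * swap 1 3) h,
      sa_pos _ _ 0 1 2 (by decide) (by decide) (by decide) (by decide)]
    rw [Md_deg01 G Gs Q (by grind) (by grind) (by grind) (by grind) (by grind)]; simp
  · rw [M_deg S Q hQ (swap 1 2) h,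
      sa_neg _ _ 1 0 2 (by decide) (by decide) (by decide) (by decide)]
    rw [Md_deg02 G Gs Q (by grind) (by grind) (by grind) (by grind) (by grind)]; simp
  · rw [M_deg S Q hQ (swap 0 3) h.symm,
      sa_neg _ _ 1 0 2 (by decide) (by decide) (by decide) (by decide)]
    rw [Md_deg02 G Gs Q (by grind) (by grind) (by grind) (by grind) (by grind)]; simp
  · rw [M_deg S Q hQ (swap 1 3) h,
      sa_neg _ _ 2 1 0 (by decide) (by decide) (by decide) (by decide)]
    rw [Md_deg03 G Gs Q (by grind) (by grind) (by grind) (by grind) (by grind)]; simp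
  · rw [M_deg S Q hQ (swap 0 2) h.symm,
      sa_neg _ _ 2 1 0 (by decide) (by decide) (by decide) (by decide)]
    rw [Md_deg03 G Gs Q (by grind) (by grind) (by grind) (by grind) (by grind)]; simp

def Dist4 {X : Type*} (x y z w : X) : Prop :=
  x ≠ y ∧ x ≠ z ∧ x ≠ w ∧ y ≠ z ∧ y ≠ w ∧ z ≠ w

lemma Dist4.inj {X : Type*} {x y z w : X} (h : Dist4 x y z w) :
    Function.Injective ![x, y, z, w] := by
  obtain ⟨a, b, c, d, e, f⟩ := h
  intro i j hij
  by_contra hne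
  fin_cases i <;> fin_cases j <;> simp_all [eq_comm]

open Classical in
noncomputable def AA {X : Type*} (S : SubMoebius X) (x y z w : X) : ℝ :=
  if Dist4 x y z w then (S.M ![x, y, z, w] 0).toReal else 0

lemma AA_spec {X : Type*} (S : SubMoebius X) {x y z w : X} (h : Dist4 x y z w) :
    ∃ u : Fin 3 → ℝ, u 0 + u 1 + u 2 = 0 ∧ S.M ![x, y, z, w] = (fun j => (u j : EReal)) ∧
      AA S x y z w = u 0 := by
  obtain ⟨u, hu, he⟩ := (S.mem_L4_iff _ (adm_of_inj h.inj)).2 h.inj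
  exact ⟨u, hu, he, by simp [AA, h, he]⟩

lemma M_perm {X : Type*} (S : SubMoebius X) {x y z w : X} (h : Dist4 x y z w)
    (π : Perm (Fin 4)) (Q' : Fin 4 → X) (hQ : ∀ k, Q' (π k) = ![x, y, z, w] k) :
    S.M Q' = signedAct3 (Equiv.Perm.sign π) (phi π) (S.M ![x, y, z, w]) := by
  rw [← S.equivariant _ (adm_of_inj h.inj) π]
  congr 1
  funext k
  rw [← hQ]
  exact congrArg Q' (π.apply_symm_apply k).symm

lemma AA_1 {X : Type*} (S : SubMoebius X) (x y z w : X) : AA S y x z w = -AA S x y z w := by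
  by_cases h : Dist4 x y z w
  · obtain ⟨u, hu, he, ha⟩ := AA_spec S h
    have h' : Dist4 y x z w := by unfold Dist4 at *; grind
    have := M_perm S h (swap 0 1) ![y, x, z, w] (by intro k; fin_cases k <;> rfl)
    rw [sa_neg _ _ 0 2 1 (by decide) (by decide) (by decide) (by decide)] at this
    rw [ha]; simp [AA, h', this, he]
  · have h' : ¬ Dist4 y x z w := by unfold Dist4 at *; grind
    simp [AA, h, h']

lemma AA_2 {X : Type*} (S : SubMoebius X) (x y z w : X) : AA S x y w z = -AA S x y z w := by
  by_cases h : Dist4 x y z w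
  · obtain ⟨u, hu, he, ha⟩ := AA_spec S h
    have h' : Dist4 x y w z := by unfold Dist4 at *; grind
    have := M_perm S h (swap 2 3) ![x, y, w, z] (by intro k; fin_cases k <;> rfl)
    rw [sa_neg _ _ 0 2 1 (by decide) (by decide) (by decide) (by decide)] at this
    rw [ha]; simp [AA, h', this, he]
  · have h' : ¬ Dist4 x y w z := by unfold Dist4 at *; grind
    simp [AA, h, h']

lemma AA_3 {X : Type*} (S : SubMoebius X) (x y z w : X) : AA S z w x y = AA S x y z w := by
  by_cases h : Dist4 x y z w
  · obtain ⟨u, hu, he, ha⟩ := AA_spec S h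
    have h' : Dist4 z w x y := by unfold Dist4 at *; grind
    have := M_perm S h (swap 0 2 * swap 1 3) ![z, w, x, y] (by intro k; fin_cases k <;> rfl)
    rw [sa_pos _ _ 0 1 2 (by decide) (by decide) (by decide) (by decide)] at this
    rw [ha]; simp [AA, h', this, he]
  · have h' : ¬ Dist4 z w x y := by unfold Dist4 at *; grind
    simp [AA, h, h']

lemma AA_rows {X : Type*} (S : SubMoebius X) {x y z w : X} (h : Dist4 x y z w) :
    (S.M ![x, y, z, w] = fun j => ((![AA S x y z w, AA S z x y w, AA S y z x w] j : ℝ) : EReal)) ∧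
    AA S x y z w + AA S y z x w + AA S z x y w = 0 := by
  obtain ⟨u, hu, he, ha⟩ := AA_spec S h
  have h1 : Dist4 z x y w := by unfold Dist4 at *; grind
  have h2 : Dist4 y z x w := by unfold Dist4 at *; grind
  have e1 := M_perm S h (swap 0 1 * swap 1 2) ![z, x, y, w] (by intro k; fin_cases k <;> rfl)
  rw [sa_pos _ _ 1 2 0 (by decide) (by decide) (by decide) (by decide)] at e1
  have e2 := M_perm S h (swap 1 2 * swap 0 1) ![y, z, x, w] (by intro k; fin_cases k <;> rfl)
  rw [sa_pos _ _ 2 0 1 (by decide) (by decide) (by decide) (by decide)] at e2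
  have a1 : AA S z x y w = u 1 := by simp [AA, h1, e1, he]
  have a2 : AA S y z x w = u 2 := by simp [AA, h2, e2, he]
  rw [ha, a1, a2, he]
  refine ⟨?_, by linarith⟩
  funext j; fin_cases j <;> simp

lemma moebius_backward {X : Type*} (S : SubMoebius X)
    (h : ∀ P : Fin 5 → X, Function.Injective P → ∃ v ∈ Rhat, deltaM S P = toE v) :
    IsMoebius S := by
  have hd1 : ∀ x y z, AA S x y z z = 0 := fun x y z => by have := AA_2 S x y z z; linarith
  obtain ⟨G, Gs, hG⟩ := realize (AA S) (AA_1 S) (AA_2 S) (AA_3 S) (by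
      intro x y z w
      by_cases hD : Dist4 x y z w
      · exact (AA_rows S hD).2
      · have h1 : ¬ Dist4 z x y w := by unfold Dist4 at *; grind
        have h2 : ¬ Dist4 y z x w := by unfold Dist4 at *; grind
        simp [AA, hD, h1, h2]) (by
      intro x y z w v hxy hxz hxw hxv hyz hyw hyv
      by_cases hzw : z = w
      · subst hzw; rw [hd1]; ring
      by_cases hwv : w = v
      · subst hwv; rw [hd1]; ring
      by_cases hzv : z = v
      · subst hzv; rw [hd1, AA_2 S x y z w]; ring
      have hinj : Function.Injective ![x, y, z, w, v] := by
        intro i j hij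
        by_contra hne
        fin_cases i <;> fin_cases j <;> simp_all [eq_comm]
      obtain ⟨V, hV, he⟩ := h _ hinj
      have hr := ((mem_Rhat V).1 hV).2.1
      have D1 : Dist4 x y z w := ⟨hxy, hxz, hxw, hyz, hyw, hzw⟩
      have D2 : Dist4 x y w v := ⟨hxy, hxw, hxv, hyw, hyv, hwv⟩
      have D3 : Dist4 x y z v := ⟨hxy, hxz, hxv, hyz, hyv, hzv⟩
      have q2 : del ![x, y, z, w, v] 2 = ![x, y, w, v] := by
        funext k; fin_cases k <;> rfl
      have q3 : del ![x, y, z, w, v] 3 = ![x, y, z, v] := by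
        funext k; fin_cases k <;> rfl
      have q4 : del ![x, y, z, w, v] 4 = ![x, y, z, w] := by
        funext k; fin_cases k <;> rfl
      have w2 := congrFun (congrFun he 2) 0
      have w3 := congrFun (congrFun he 3) 0
      have w4 := congrFun (congrFun he 4) 0
      simp only [deltaM, toE, q2, q3, q4] at w2 w3 w4
      have a1 : AA S x y z w = V 4 0 := by simp [AA, D1, w4]
      have a2 : AA S x y w v = V 2 0 := by simp [AA, D2, w2]
      have a3 : AA S x y z v = V 3 0 := by simp [AA, D3, w3]
      linarith)
  refine ⟨mkMetric G Gs, fun Q hQ => ?_⟩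
  by_cases hi : Function.Injective Q
  · have D : Dist4 (Q 0) (Q 1) (Q 2) (Q 3) :=
      ⟨fun h => absurd (hi h) (by decide), fun h => absurd (hi h) (by decide),
       fun h => absurd (hi h) (by decide), fun h => absurd (hi h) (by decide),
       fun h => absurd (hi h) (by decide), fun h => absurd (hi h) (by decide)⟩
    rw [Md_mk_inj G Gs Q hi]
    have hQe : Q = ![Q 0, Q 1, Q 2, Q 3] := by funext k; fin_cases k <;> rfl
    conv_lhs => rw [hQe]
    rw [(AA_rows S D).1]
    obtain ⟨a, b, c, d, e, f⟩ := D
    funext j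
    congr 1
    rw [hG _ _ _ _ a b c d e f, hG _ _ _ _ b.symm d.symm f a c e,
      hG _ _ _ _ d a.symm e b.symm f c]
    rw [Gs (Q 2) (Q 1), Gs (Q 2) (Q 0), Gs (Q 1) (Q 0)]
    fin_cases j <;> simp [cr3] <;> ring
  · exact M_eq_Md_deg S G Gs Q hQ hi


/-- Theorem 1.1 (main theorem): a sub-Möbius structure `M` on a set `X` is a Möbius
structure if and only if `δM(reg 𝒫₅) ⊆ R`, where `R = R̂ = ⋂_{λ∈Λ} {v ∈ L₅ : r_λ(v) = 0}`
is the irreducible component of the canonical representation `η₅` corresponding to the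
prime character `χ^{32}`: a 5-dimensional `η₅`-invariant subspace of `L₅` on which `η₅`
restricts to an irreducible representation whose trace on every transposition is `1`. -/
theorem main_theorem {X : Type*} (S : SubMoebius X) :
    ((∀ π : Equiv.Perm (Fin 5), ∀ v ∈ Rhat, eta5lin π v ∈ Rhat) ∧
     Module.finrank ℝ Rhat = 5 ∧
     (∀ W : Submodule ℝ (Fin 5 → Fin 3 → ℝ), W ≤ Rhat →
       (∀ π : Equiv.Perm (Fin 5), ∀ v ∈ W, eta5lin π v ∈ W) → W = ⊥ ∨ W = Rhat) ∧
     (∀ π : Equiv.Perm (Fin 5), π.cycleType = {2} →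
       ∀ h : ∀ v ∈ Rhat, eta5lin π v ∈ Rhat,
         LinearMap.trace ℝ Rhat ((eta5lin π).restrict h) = 1)) ∧
    (IsMoebius S ↔
      ∀ P : Fin 5 → X, Function.Injective P → ∃ v ∈ Rhat, deltaM S P = toE v) := by
  exact ⟨⟨Rhat_inv, Rhat_finrank, Rhat_irred, Rhat_trace⟩,
    ⟨fun h P hP => moebius_forward S h P hP, moebius_backward S⟩⟩
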